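/- There exists R_G > 0 with the following property, for each choice of sign ±: if (x,ξ) ∈ ℝ^{2d}, γ > 0 and t₀ > 0 are such that |X(±t₀, x, ξ)| ≥ max(R_G, |x| + γ), then |X(±t, x, ξ)| ≥ max(R_G, |x| + γ) for every t ≥ t₀, and moreover |X(±t, x, ξ)| → +∞ as t → +∞. -/

import Mathlib

open MeasureTheory Complex Filter
open scoped ENNReal NNReal Topology

noncomputable section

/-- Euclidean space `ℝ^d`. -/
abbrev Ed (d : ℕ) := EuclideanSpace ℝ (Fin d)

/-- The Japanese bracket `⟨x⟩ = (1 + |x|²)^(1/2)`. -/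
def jap {d : ℕ} (x : Ed d) : ℝ := Real.sqrt (1 + ‖x‖ ^ 2)

/-- The geometric data of the problem: a long-range perturbation `G` of the identity matrix
(smooth, symmetric, positive definite, with symbol-like decay of all derivatives) and a
short-range nonnegative smooth absorption index `a`. -/
structure GeomSetup (d : ℕ) : Type where
  G : Ed d → Matrix (Fin d) (Fin d) ℝ
  a : Ed d → ℝ
  ρ : ℝ
  ρ_pos : 0 < ρ
  G_smooth : ∀ j k, ContDiff ℝ (⊤ : ℕ∞) fun x => G x j k
  G_symm : ∀ x, (G x).IsSymm
  G_posdef : ∀ x, (G x).PosDef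
  G_decay : ∀ n : ℕ, ∃ c : ℝ, ∀ j k, ∀ x : Ed d,
    ‖iteratedFDeriv ℝ n (fun y : Ed d => G y j k - if j = k then (1 : ℝ) else 0) x‖
      ≤ c * jap x ^ (-ρ - (n : ℝ))
  a_smooth : ContDiff ℝ (⊤ : ℕ∞) a
  a_nonneg : ∀ x, 0 ≤ a x
  a_decay : ∀ n : ℕ, ∃ c : ℝ, ∀ x : Ed d,
    ‖iteratedFDeriv ℝ n a x‖ ≤ c * jap x ^ (-1 - ρ - (n : ℝ))

/-- The principal symbol `p(x,ξ) = ⟨G(x)ξ, ξ⟩`. -/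
def pHam {d : ℕ} (S : GeomSetup d) (w : Ed d × Ed d) : ℝ :=
  ∑ j, ∑ k, S.G w.1 j k * w.2 j * w.2 k

/-- `Φ` is the (globally defined) Hamiltonian flow of `p`:
`∂_t X = ∇_ξ p`, `∂_t Ξ = -∇_x p`, `Φ⁰ = id`. -/
def IsHamFlow {d : ℕ} (S : GeomSetup d) (Φ : ℝ → Ed d × Ed d → Ed d × Ed d) : Prop :=
  (∀ w, Φ 0 w = w) ∧
  ∀ w t, HasDerivAt (fun s => Φ s w)
    (gradient (fun ξ => pHam S ((Φ t w).1, ξ)) (Φ t w).2,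
     -gradient (fun x => pHam S (x, (Φ t w).2)) (Φ t w).1) t

/-- The forward (`σ = 1`) and backward (`σ = -1`) trapped sets
`Ω_b^± = {w : sup_{t ≥ 0} |X(±t,w)| < ∞}`. -/
def OmegaB {d : ℕ} (Φ : ℝ → Ed d × Ed d → Ed d × Ed d) (σ : ℝ) : Set (Ed d × Ed d) :=
  {w | ∃ M : ℝ, ∀ t : ℝ, 0 ≤ t → ‖(Φ (σ * t) w).1‖ ≤ M}

/-- The forward (`σ = 1`) and backward (`σ = -1`) non-trapped sets
`Ω_∞^± = {w : |X(±t,w)| → ∞ as t → ∞}`. -/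
def OmegaInf {d : ℕ} (Φ : ℝ → Ed d × Ed d → Ed d × Ed d) (σ : ℝ) : Set (Ed d × Ed d) :=
  {w | Filter.Tendsto (fun t => ‖(Φ (σ * t) w).1‖) Filter.atTop Filter.atTop}

/-- Geometric control: every trapped trajectory of positive energy meets the damping
region `{a > 0}`. -/
def GeoControl {d : ℕ} (S : GeomSetup d) (Φ : ℝ → Ed d × Ed d → Ed d × Ed d) : Prop :=
  ∀ w ∈ OmegaB Φ 1 ∩ OmegaB Φ (-1), 0 < pHam S w → ∃ t : ℝ, 0 < S.a ((Φ t w).1)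

section

open scoped RealInnerProductSpace

/-- A function whose second derivative is nonnegative on an interval stays above its tangent at
the left endpoint. -/
lemma tangent_le_of_second_deriv_nonneg {h h' h'' : ℝ → ℝ}
    (hd : ∀ t, HasDerivAt h (h' t) t) (hd' : ∀ t, HasDerivAt h' (h'' t) t) {a b : ℝ}
    (hab : a ≤ b) (hpos : ∀ t ∈ Set.Ioo a b, 0 ≤ h'' t) :
    h a + h' a * (b - a) ≤ h b := by
  have mono' : MonotoneOn h' (Set.Icc a b) := by
    refine monotoneOn_of_deriv_nonneg (convex_Icc a b)
      (fun t _ => (hd' t).continuousAt.continuousWithinAt)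
      (fun t _ => (hd' t).differentiableAt.differentiableWithinAt) fun t ht => ?_
    rw [(hd' t).deriv]
    exact hpos t (by simpa using ht)
  have hdk : ∀ t, HasDerivAt (fun s => h s - h' a * s) (h' t - h' a) t := fun t =>
    ((hd t).sub ((hasDerivAt_id t).const_mul (h' a))).congr_deriv (by simp)
  have mono : MonotoneOn (fun s => h s - h' a * s) (Set.Icc a b) := by
    refine monotoneOn_of_deriv_nonneg (convex_Icc a b)
      (fun t _ => (hdk t).continuousAt.continuousWithinAt)
      (fun t _ => (hdk t).differentiableAt.differentiableWithinAt) fun t ht => ?_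
    rw [(hdk t).deriv, sub_nonneg]
    exact mono' (Set.left_mem_Icc.2 hab) (interior_subset ht) (interior_subset ht).1
  have := mono (Set.left_mem_Icc.2 hab) (Set.right_mem_Icc.2 hab) hab
  simp only at this
  linarith

/-- If `h` is convex wherever it exceeds `R`, then once above `R` with nonnegative slope it stays
above its tangent. -/
lemma tangent_le_of_convex_above {h h' h'' : ℝ → ℝ}
    (hd : ∀ t, HasDerivAt h (h' t) t) (hd' : ∀ t, HasDerivAt h' (h'' t) t) {R : ℝ}
    (hpos : ∀ t, R < h t → 0 ≤ h'' t) {a : ℝ} (ha : R < h a) (ha' : 0 ≤ h' a)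
    {t : ℝ} (hat : a ≤ t) : h a + h' a * (t - a) ≤ h t := by
  have above : ∀ s, a ≤ s → R < h s := by
    by_contra! hcon
    have hcont : Continuous h := continuous_iff_continuousAt.2 fun s => (hd s).continuousAt
    have hclosed : IsClosed {s | a ≤ s ∧ h s ≤ R} :=
      isClosed_Ici.inter (isClosed_le hcont continuous_const)
    have hbdd : BddBelow {s | a ≤ s ∧ h s ≤ R} := ⟨a, fun s hs => hs.1⟩
    obtain ⟨haτ, hτ⟩ := hclosed.csInf_mem hcon hbdd
    set τ := sInf {s | a ≤ s ∧ h s ≤ R}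
    have hlt : ∀ s ∈ Set.Ioo a τ, 0 ≤ h'' s := fun s hs => hpos s <| by
      by_contra! hle
      exact (csInf_le hbdd ⟨hs.1.le, hle⟩).not_gt hs.2
    have := tangent_le_of_second_deriv_nonneg hd hd' haτ hlt
    nlinarith [mul_nonneg ha' (sub_nonneg.2 haτ)]
  exact tangent_le_of_second_deriv_nonneg hd hd' hat fun s hs => hpos s (above s hs.1.le)

/-- If `h` is convex wherever it exceeds `R`, and at time `t₀ > 0` it exceeds both `R` and its
initial value, then it never returns below `h t₀` and tends to infinity. -/
lemma escape_of_convex_above {h h' h'' : ℝ → ℝ}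
    (hd : ∀ t, HasDerivAt h (h' t) t) (hd' : ∀ t, HasDerivAt h' (h'' t) t) {R : ℝ}
    (hpos : ∀ t, R < h t → 0 ≤ h'' t) {t₀ : ℝ} (ht₀ : 0 < t₀) (hR : R < h t₀)
    (h0 : h 0 < h t₀) :
    (∀ t, t₀ ≤ t → h t₀ ≤ h t) ∧ Tendsto h atTop atTop := by
  have slope_pos : 0 < h' t₀ := by
    by_contra! hle
    have hk : ∀ t, HasDerivAt (fun s => h (-s)) (-h' (-t)) t := fun t =>
      ((hd (-t)).scomp t (hasDerivAt_neg t)).congr_deriv (by simp)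
    have hk' : ∀ t, HasDerivAt (fun s => -h' (-s)) (h'' (-t)) t := fun t =>
      ((hd' (-t)).scomp t (hasDerivAt_neg t)).neg.congr_deriv (by simp)
    have := tangent_le_of_convex_above hk hk' (fun t => hpos (-t)) (a := -t₀) (t := 0)
      (by simpa using hR) (by simpa using hle) (by linarith)
    simp only [neg_neg, neg_zero] at this
    nlinarith
  have key : ∀ t, t₀ ≤ t → h t₀ + h' t₀ * (t - t₀) ≤ h t := fun t =>
    tangent_le_of_convex_above hd hd' hpos hR slope_pos.le
  refine ⟨fun t ht => ?_, ?_⟩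
  · nlinarith [key t ht, mul_nonneg slope_pos.le (sub_nonneg.2 ht)]
  · refine tendsto_atTop_mono' atTop ((eventually_ge_atTop t₀).mono key) ?_
    refine tendsto_atTop_add_const_left _ _ (Tendsto.const_mul_atTop slope_pos ?_)
    exact tendsto_atTop_add_const_right _ _ tendsto_id

/-- The linear operator attached to the matrix `G x`. -/
def GeomSetup.op {d : ℕ} (S : GeomSetup d) (x : Ed d) : Ed d →L[ℝ] Ed d :=
  ∑ j, ∑ k, S.G x j k •
    (EuclideanSpace.proj (𝕜 := ℝ) k).smulRight (EuclideanSpace.single j (1 : ℝ))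

variable {d : ℕ} (S : GeomSetup d)

lemma GeomSetup.op_apply (x ξ : Ed d) (j : Fin d) :
    S.op x ξ j = ∑ k, S.G x j k * ξ k := by
  simp [GeomSetup.op, Pi.single_apply]

lemma GeomSetup.inner_op (x ξ η : Ed d) :
    ⟪S.op x ξ, η⟫ = ∑ j, ∑ k, S.G x j k * η j * ξ k := by
  rw [PiLp.inner_apply]
  refine Finset.sum_congr rfl fun j _ => ?_
  simp only [S.op_apply, RCLike.inner_apply, conj_trivial, Finset.mul_sum]
  exact Finset.sum_congr rfl fun k _ => by ring

lemma GeomSetup.inner_op_comm (x ξ η : Ed d) : ⟪S.op x ξ, η⟫ = ⟪ξ, S.op x η⟫ := by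
  rw [real_inner_comm _ ξ, S.inner_op, S.inner_op, Finset.sum_comm]
  refine Finset.sum_congr rfl fun j _ => Finset.sum_congr rfl fun k _ => ?_
  rw [(S.G_symm x).apply]
  ring

lemma pHam_eq_inner_op (x ξ : Ed d) : pHam S (x, ξ) = ⟪S.op x ξ, ξ⟫ := by
  rw [S.inner_op]; rfl

lemma GeomSetup.differentiable_op : Differentiable ℝ S.op := by
  have h := fun j k => (S.G_smooth j k).differentiable (by simp)
  unfold GeomSetup.op
  fun_prop

lemma gradient_pHam_momentum (x ξ : Ed d) :
    gradient (fun η => pHam S (x, η)) ξ = (2 : ℝ) • S.op x ξ := by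
  refine HasGradientAt.gradient ?_
  rw [hasGradientAt_iff_hasFDerivAt]
  simp_rw [pHam_eq_inner_op]
  refine ((S.op x).hasFDerivAt.inner ℝ (hasFDerivAt_id ξ)).congr_fderiv ?_
  ext η
  simp [S.inner_op_comm x η, real_inner_comm]
  ring

lemma norm_gradient_pHam_position_le (x ξ : Ed d) :
    ‖gradient (fun y => pHam S (y, ξ)) x‖ ≤ ‖fderiv ℝ S.op x‖ * ‖ξ‖ ^ 2 := by
  rw [gradient, LinearIsometryEquiv.norm_map]
  simp_rw [pHam_eq_inner_op]
  have h1 := ((S.differentiable_op x).hasFDerivAt.clm_apply (hasFDerivAt_const ξ x)).inner ℝ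
    (hasFDerivAt_const ξ x)
  rw [h1.fderiv]
  refine ContinuousLinearMap.opNorm_le_bound _ (by positivity) fun v => ?_
  simp
  calc |⟪(fderiv ℝ S.op x v) ξ, ξ⟫| ≤ ‖(fderiv ℝ S.op x v) ξ‖ * ‖ξ‖ := abs_real_inner_le_norm _ _
    _ ≤ ‖fderiv ℝ S.op x‖ * ‖v‖ * ‖ξ‖ * ‖ξ‖ := by
      gcongr
      exact (fderiv ℝ S.op x).le_opNorm₂ v ξ
    _ = _ := by ring

lemma norm_le_jap (x : Ed d) : ‖x‖ ≤ jap x := Real.le_sqrt_of_sq_le (by linarith)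

lemma jap_pos (x : Ed d) : 0 < jap x := Real.sqrt_pos.2 (by positivity)

lemma norm_sum_sum_smulRight_le {ι κ E F : Type*} [Fintype ι] [Fintype κ]
    [NormedAddCommGroup E] [NormedSpace ℝ E] [NormedAddCommGroup F] [NormedSpace ℝ F]
    (f : ι → κ → E →L[ℝ] ℝ) (e : ι → κ → F) :
    ‖∑ j, ∑ k, (f j k).smulRight (e j k)‖ ≤ ∑ j, ∑ k, ‖f j k‖ * ‖e j k‖ := by
  refine norm_sum_le_of_le _ fun j _ => norm_sum_le_of_le _ fun k _ => ?_
  rw [ContinuousLinearMap.norm_smulRight_apply]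

/-- The decay of the entries of `G - 1` carries over to the operator `S.op`. -/
lemma exists_op_bounds : ∃ C : ℝ, ∀ x : Ed d,
    ‖S.op x - 1‖ ≤ C * jap x ^ (-S.ρ) ∧ ‖x‖ * ‖fderiv ℝ S.op x‖ ≤ C * jap x ^ (-S.ρ) := by
  obtain ⟨c₀, h₀⟩ := S.G_decay 0
  obtain ⟨c₁, h₁⟩ := S.G_decay 1
  set e : Fin d → Fin d → Ed d →L[ℝ] Ed d := fun j k =>
    (EuclideanSpace.proj (𝕜 := ℝ) k).smulRight (EuclideanSpace.single j (1 : ℝ)) with he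
  set c := max (max c₀ c₁) 0
  have hop : ∀ x, S.op x - 1 =
      ∑ j, ∑ k, (S.G x j k - if j = k then (1 : ℝ) else 0) • e j k := fun x => by
    ext ξ j
    simp [S.op_apply, he, Pi.single_apply, sub_mul,
      Finset.sum_sub_distrib]
  have hD : ∀ j k (x : Ed d), DifferentiableAt ℝ
      (fun y : Ed d => S.G y j k - if j = k then (1 : ℝ) else 0) x := fun j k x =>
    ((S.G_smooth j k).differentiable (by simp) x).sub_const _
  have hfderiv : ∀ x, fderiv ℝ S.op x = ∑ j, ∑ k,
      (fderiv ℝ (fun y : Ed d => S.G y j k - if j = k then (1 : ℝ) else 0) x).smulRight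
        (e j k) := fun x => by
    have h := HasFDerivAt.fun_sum (u := Finset.univ) fun j _ =>
      HasFDerivAt.fun_sum (u := Finset.univ) fun k _ =>
        (hD j k x).hasFDerivAt.smul_const (e j k)
    rw [← h.fderiv]
    simp_rw [← hop]
    rw [fderiv_sub_const]
  refine ⟨∑ j, ∑ k, c * ‖e j k‖, fun x => ⟨?_, ?_⟩⟩
  · rw [hop, Finset.sum_mul]
    refine norm_sum_le_of_le _ fun j _ => ?_
    rw [Finset.sum_mul]
    refine norm_sum_le_of_le _ fun k _ => ?_
    rw [norm_smul, mul_right_comm]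
    gcongr
    have := h₀ j k x
    rw [norm_iteratedFDeriv_zero] at this
    refine this.trans ?_
    simp only [Nat.cast_zero, sub_zero]
    have := jap_pos x
    gcongr
    simp [c]
  · rw [hfderiv, Finset.sum_mul]
    refine (mul_le_mul_of_nonneg_left (norm_sum_sum_smulRight_le _ e) (norm_nonneg x)).trans ?_
    simp_rw [Finset.mul_sum, Finset.sum_mul]
    refine Finset.sum_le_sum fun j _ => Finset.sum_le_sum fun k _ => ?_
    rw [← mul_assoc, mul_right_comm c]
    refine mul_le_mul_of_nonneg_right ?_ (norm_nonneg _)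
    have h := h₁ j k x
    rw [norm_iteratedFDeriv_one] at h
    have hj := jap_pos x
    have hc : c₁ ≤ c := by simp [c]
    generalize ‖fderiv ℝ (fun y : Ed d => S.G y j k - if j = k then (1 : ℝ) else 0) x‖ = D at h ⊢
    have hD₁ : D ≤ c * jap x ^ (-S.ρ - 1) := h.trans (by simp only [Nat.cast_one]; gcongr)
    have hnonneg : 0 ≤ c * jap x ^ (-S.ρ - 1) := mul_nonneg (le_max_right _ _) (by positivity)
    calc ‖x‖ * D ≤ jap x * (c * jap x ^ (-S.ρ - 1)) :=
          (mul_le_mul_of_nonneg_left hD₁ (norm_nonneg x)).trans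
            (mul_le_mul_of_nonneg_right (norm_le_jap x) hnonneg)
      _ = c * jap x ^ (-S.ρ) := by
          rw [Real.rpow_sub_one hj.ne']
          field_simp

lemma exists_radius_op_close : ∃ R : ℝ, 0 < R ∧ ∀ x : Ed d, R ≤ ‖x‖ →
    ‖S.op x - 1‖ ≤ 1 / 9 ∧ ‖x‖ * ‖fderiv ℝ S.op x‖ ≤ 1 / 9 := by
  obtain ⟨C, hC⟩ := exists_op_bounds S
  have hlim : Tendsto (fun s : ℝ => C * s ^ (-S.ρ)) atTop (𝓝 0) := by
    simpa using (tendsto_rpow_neg_atTop S.ρ_pos).const_mul C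
  obtain ⟨R, hR⟩ := eventually_atTop.1
    (hlim.eventually (eventually_le_nhds (by norm_num : (0 : ℝ) < 1 / 9)))
  refine ⟨max R 1, by positivity, fun x hx => ?_⟩
  have := hR (jap x) ((le_max_left _ _).trans (hx.trans (norm_le_jap x)))
  exact ⟨(hC x).1.trans this, (hC x).2.trans this⟩

/-- The second derivative of `‖X‖²` along a trajectory, divided by four, at position `x`,
momentum `ξ`, where `v` is minus the position gradient of the Hamiltonian. -/
def radialAccel (x ξ v : Ed d) : ℝ :=
  ⟪x, (fderiv ℝ S.op x ((2 : ℝ) • S.op x ξ)) ξ + S.op x v⟫ + ⟪(2 : ℝ) • S.op x ξ, S.op x ξ⟫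

lemma radialAccel_nonneg {x ξ v : Ed d} (h₀ : ‖S.op x - 1‖ ≤ 1 / 9)
    (h₁ : ‖x‖ * ‖fderiv ℝ S.op x‖ ≤ 1 / 9) (hv : ‖v‖ ≤ ‖fderiv ℝ S.op x‖ * ‖ξ‖ ^ 2) :
    0 ≤ radialAccel S x ξ v := by
  have hdiff : ∀ w, ‖S.op x w - w‖ ≤ 1 / 9 * ‖w‖ := fun w =>
    (S.op x - 1).le_of_opNorm_le h₀ w
  have hup : ∀ w, ‖S.op x w‖ ≤ 10 / 9 * ‖w‖ := fun w => by
    linarith [hdiff w, norm_sub_norm_le (S.op x w) w]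
  have hlow : 8 / 9 * ‖ξ‖ ≤ ‖S.op x ξ‖ := by
    linarith [hdiff ξ, norm_sub_norm_le ξ (S.op x ξ), norm_sub_rev ξ (S.op x ξ)]
  have hsum : ‖(fderiv ℝ S.op x ((2 : ℝ) • S.op x ξ)) ξ + S.op x v‖
      ≤ 30 / 9 * (‖fderiv ℝ S.op x‖ * ‖ξ‖ ^ 2) := by
    refine (norm_add_le _ _).trans ?_
    have e₁ : ‖(fderiv ℝ S.op x ((2 : ℝ) • S.op x ξ)) ξ‖
        ≤ ‖fderiv ℝ S.op x‖ * (2 * (10 / 9 * ‖ξ‖)) * ‖ξ‖ := by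
      refine ((fderiv ℝ S.op x).le_opNorm₂ _ ξ).trans ?_
      rw [norm_smul, Real.norm_ofNat]
      gcongr
      exact hup ξ
    nlinarith [hup v]
  have hinner := neg_le_of_abs_le (abs_real_inner_le_norm x
    ((fderiv ℝ S.op x ((2 : ℝ) • S.op x ξ)) ξ + S.op x v))
  have e₂ := mul_le_mul_of_nonneg_left hsum (norm_nonneg x)
  have e₃ := mul_le_mul_of_nonneg_right h₁ (sq_nonneg ‖ξ‖)
  have e₄ : (8 / 9 * ‖ξ‖) ^ 2 ≤ ‖S.op x ξ‖ ^ 2 := by gcongr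
  rw [radialAccel, real_inner_smul_left, real_inner_self_eq_norm_sq]
  nlinarith [sq_nonneg ‖ξ‖]

end

/-- **Escape for the Hamiltonian flow at infinity** (Lemma 8.2).
There exists `R_G > 0` such that, for each sign `σ = ±1`: if
`|X(σ t₀, x, ξ)| ≥ max(R_G, |x| + γ)` for some `γ > 0` and `t₀ > 0`, then the same holds
with `t₀` replaced by any `t ≥ t₀`, and `|X(σ t, x, ξ)| → ∞` as `t → ∞`. -/
theorem flow_escape_lemma
    (d : ℕ) (hd : 3 ≤ d) (S : GeomSetup d)
    (Φ : ℝ → Ed d × Ed d → Ed d × Ed d) (hΦ : IsHamFlow S Φ) :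
    ∃ RG : ℝ, 0 < RG ∧ ∀ σ : ℝ, σ = 1 ∨ σ = -1 →
      ∀ (x ξ : Ed d) (γ t₀ : ℝ), 0 < γ → 0 < t₀ →
        max RG (‖x‖ + γ) ≤ ‖(Φ (σ * t₀) (x, ξ)).1‖ →
        (∀ t : ℝ, t₀ ≤ t → max RG (‖x‖ + γ) ≤ ‖(Φ (σ * t) (x, ξ)).1‖) ∧
        Filter.Tendsto (fun t => ‖(Φ (σ * t) (x, ξ)).1‖) Filter.atTop Filter.atTop := by
  obtain ⟨R, hR0, hR⟩ := exists_radius_op_close S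
  refine ⟨R + 1, by linarith, fun σ hσ x ξ γ t₀ hγ ht₀ hmax => ?_⟩
  have hσ2 : σ * σ = 1 := by rcases hσ with rfl | rfl <;> norm_num
  set w : Ed d × Ed d := (x, ξ)
  set X : ℝ → Ed d := fun t => (Φ t w).1
  set P : ℝ → Ed d := fun t => (Φ t w).2
  set F : ℝ → Ed d := fun t => -gradient (fun y => pHam S (y, P t)) (X t)
  have hX : ∀ t, HasDerivAt X ((2 : ℝ) • S.op (X t) (P t)) t := fun t => by
    rw [← gradient_pHam_momentum]
    exact (ContinuousLinearMap.fst ℝ (Ed d) (Ed d)).hasFDerivAt.comp_hasDerivAt t (hΦ.2 w t)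
  have hP : ∀ t, HasDerivAt P (F t) t := fun t =>
    (ContinuousLinearMap.snd ℝ (Ed d) (Ed d)).hasFDerivAt.comp_hasDerivAt t (hΦ.2 w t)
  have hh : ∀ t, HasDerivAt (fun s => ‖X s‖ ^ 2)
      (4 * inner ℝ (X t) (S.op (X t) (P t))) t := fun t => by
    refine (hX t).norm_sq.congr_deriv ?_
    rw [real_inner_smul_right]
    ring
  have hh' : ∀ t, HasDerivAt (fun s => 4 * inner ℝ (X s) (S.op (X s) (P s)))
      (4 * radialAccel S (X t) (P t) (F t)) t := fun t =>
    ((hX t).inner ℝ ((((S.differentiable_op (X t)).hasFDerivAt.comp_hasDerivAt t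
      (hX t))).clm_apply (hP t))).const_mul 4
  have hpos : ∀ t, R ^ 2 < ‖X t‖ ^ 2 → 0 ≤ 4 * radialAccel S (X t) (P t) (F t) := fun t ht => by
    obtain ⟨h₀, h₁⟩ := hR (X t) (lt_of_pow_lt_pow_left₀ 2 (norm_nonneg _) ht).le
    refine mul_nonneg (by norm_num) (radialAccel_nonneg S h₀ h₁ ?_)
    rw [norm_neg]
    exact norm_gradient_pHam_position_le S _ _
  have hmul : ∀ t, HasDerivAt (fun s => σ * s) σ t := fun t => by
    simpa using (hasDerivAt_id t).const_mul σ
  have hk : ∀ t, HasDerivAt (fun s => ‖X (σ * s)‖ ^ 2)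
      (σ * (4 * inner ℝ (X (σ * t)) (S.op (X (σ * t)) (P (σ * t))))) t := fun t =>
    (hh (σ * t)).scomp t (hmul t)
  have hk' : ∀ t, HasDerivAt
      (fun s => σ * (4 * inner ℝ (X (σ * s)) (S.op (X (σ * s)) (P (σ * s)))))
      (4 * radialAccel S (X (σ * t)) (P (σ * t)) (F (σ * t))) t := fun t => by
    refine (((hh' (σ * t)).scomp t (hmul t)).const_mul σ).congr_deriv ?_
    rw [smul_eq_mul, ← mul_assoc, hσ2, one_mul]
  have hX0 : X (σ * 0) = x := by simp [X, hΦ.1, w]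
  have hR₀ : R < ‖X (σ * t₀)‖ := by linarith [(le_max_left _ _).trans hmax]
  have hx₀ : ‖x‖ < ‖X (σ * t₀)‖ := by linarith [(le_max_right _ _).trans hmax]
  obtain ⟨hstay, hlim⟩ := escape_of_convex_above hk hk' (fun t => hpos (σ * t)) ht₀
    (by gcongr) (by simp only [hX0]; gcongr)
  refine ⟨fun t ht => hmax.trans (le_of_sq_le_sq (hstay t ht) (norm_nonneg _)), ?_⟩
  have := Real.tendsto_sqrt_atTop.comp hlim
  refine this.congr fun t => ?_
  simp [X]
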